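/- Let n ≥ 2 and γ ∈ (0,1), and set s := n/2 + γ and a := 1 − 2γ. Let v be a positive C² function on ℝ₊^{n+1} satisfying y²Δv − (n−1)y∂_y v + s(n−s)v = 0 on ℝ₊^{n+1}. Define w(x,y) := 1 − v(x,y)/y^{n−s} and ρ := v^{1/(n−s)}. Assume: (1) w belongs to H̃^{1,a}(ℝ₊^{n+1}) and lim_{y→0⁺} w(x,y) = 0 for every x ∈ ℝⁿ; (2) y|∇ρ| ≤ ρ on ℝ₊^{n+1} (i.e. |∇*_s ρ|_{g*_s} ≤ 1 for the adapted metric). Then v(x,y) = y^{n−s} for all (x,y) ∈ ℝ₊^{n+1}, i.e. the adapted metric g*_s is the Euclidean metric. -/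

import Mathlib

open MeasureTheory Filter Set Topology
open scoped ENNReal NNReal

noncomputable section

/-- The Euclidean space `ℝ^{n+1}`. -/
abbrev E (n : ℕ) := EuclideanSpace ℝ (Fin (n + 1))

/-- The last coordinate `y` of a point `z = (x, y) ∈ ℝ^{n+1}`. -/
def ycoord {n : ℕ} (z : E n) : ℝ := z (Fin.last n)

/-- The open upper half-space `ℝ₊^{n+1}`. -/
def upperHalf (n : ℕ) : Set (E n) := {z | 0 < ycoord z}

/-- The open upper half-ball `B_r⁺`. -/
def Bplus (n : ℕ) (r : ℝ) : Set (E n) := {z | 0 < ycoord z ∧ ‖z‖ < r}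

/-- The upper hemisphere `(∂B_r)⁺`. -/
def sphPlus (n : ℕ) (r : ℝ) : Set (E n) := {z | 0 < ycoord z ∧ ‖z‖ = r}

/-- The point `(x, y) ∈ ℝ^{n+1}` built from `x ∈ ℝⁿ` and `y ∈ ℝ`. -/
def pt {n : ℕ} (x : EuclideanSpace ℝ (Fin n)) (y : ℝ) : E n :=
  (EuclideanSpace.equiv (Fin (n + 1)) ℝ).symm (Fin.snoc (fun i => x i) y)

/-- The unit vector `e_{n+1}` in the `y`-direction. -/
def eY (n : ℕ) : E n := EuclideanSpace.single (Fin.last n) (1 : ℝ)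

/-- The partial derivative `∂_y u` in the `y`-direction. -/
def partialY {n : ℕ} (u : E n → ℝ) (z : E n) : ℝ := fderiv ℝ u z (eY n)

/-- The Euclidean Laplacian `Δu = ∑ ∂²u/∂z_i²`. -/
def lap {n : ℕ} (u : E n → ℝ) (z : E n) : ℝ :=
  ∑ i : Fin (n + 1),
    fderiv ℝ (fun w => fderiv ℝ u w (EuclideanSpace.single i (1 : ℝ))) z
      (EuclideanSpace.single i (1 : ℝ))

/-- A C¹ function with compact support contained in `{z : ‖z‖ ≤ r, y > 0}`. -/
def IsTestFn (n : ℕ) (r : ℝ) (φ : E n → ℝ) : Prop :=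
  ContDiff ℝ 1 φ ∧ tsupport φ ⊆ {z : E n | ‖z‖ ≤ r ∧ 0 < ycoord z}

/-- The `y^a`-weighted Sobolev energy `∫_{B_r⁺} (|∇u|² + u²) y^a dz`. -/
def wInt (n : ℕ) (a : ℝ) (u : E n → ℝ) (r : ℝ) : ℝ≥0∞ :=
  ∫⁻ z in Bplus n r, ENNReal.ofReal ((‖gradient u z‖ ^ 2 + (u z) ^ 2) * (ycoord z) ^ a)

/-- Membership in `H^{1,a}(ℝ₊^{n+1})`: locally finite weighted Sobolev norm. -/
def memH1 (n : ℕ) (a : ℝ) (u : E n → ℝ) : Prop := ∀ r > 0, wInt n a u r < ⊤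

/-- Membership in `H̃^{1,a}(ℝ₊^{n+1})`: finite local weighted norm together with
approximability by C¹ functions compactly supported away from the boundary. -/
def memH1T (n : ℕ) (a : ℝ) (u : E n → ℝ) : Prop :=
  memH1 n a u ∧ ∀ r > 0, ∃ φ : ℕ → E n → ℝ, (∀ k, IsTestFn n r (φ k)) ∧
    Tendsto (fun k => wInt n a (fun z => u z - φ k z) r) atTop (nhds 0)



lemma second_deriv_test (g g' : ℝ → ℝ) (g2 : ℝ) (h1 : ∀ᶠ t in 𝓝 0, HasDerivAt g (g' t) t)
    (h2 : HasDerivAt g' g2 0) (hm : IsLocalMin g 0) : g' 0 = 0 ∧ 0 ≤ g2 := by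
  have h0 : g' 0 = 0 := hm.hasDerivAt_eq_zero h1.self_of_nhds
  refine ⟨h0, ?_⟩
  by_contra hneg
  push Not at hneg
  have hd : deriv g =ᶠ[𝓝 0] g' := h1.mono fun t ht => ht.deriv
  have hdd : HasDerivAt (deriv g) g2 0 := h2.congr_of_eventuallyEq hd
  have hmax : IsLocalMax g 0 := by
    apply isLocalMax_of_deriv_deriv_neg
    · rw [hdd.deriv]; exact hneg
    · rw [h1.self_of_nhds.deriv, h0]
    · exact h1.self_of_nhds.continuousAt
  have hc : g =ᶠ[𝓝 0] fun _ => g 0 := by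
    filter_upwards [hm, hmax] with t a b
    exact le_antisymm b a
  have h3 : deriv g =ᶠ[𝓝 0] fun _ => 0 := by
    have := hc.deriv
    simpa using this
  have h4 : HasDerivAt (fun _ : ℝ => (0:ℝ)) g2 0 := hdd.congr_of_eventuallyEq h3.symm
  have := h4.unique (hasDerivAt_const 0 0)
  linarith

lemma ycoord_line {n : ℕ} (z : E n) (t : ℝ) : ycoord (z + t • eY n) = ycoord z + t := by
  simp [ycoord, eY]

lemma ycoord_line' {n : ℕ} (z : E n) (t : ℝ) (i : Fin (n+1)) (hi : i ≠ Fin.last n) :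
    ycoord (z + t • EuclideanSpace.single i (1:ℝ)) = ycoord z := by
  simp [ycoord, hi.symm]

lemma norm_line {n : ℕ} (z : E n) (t : ℝ) (i : Fin (n+1)) :
    ‖z + t • EuclideanSpace.single i (1:ℝ)‖^2 = ‖z‖^2 + 2 * t * z i + t^2 := by
  rw [norm_add_sq_real, inner_smul_right, EuclideanSpace.inner_single_right, norm_smul]
  simp
  ring

lemma continuous_ycoord (n : ℕ) : Continuous (ycoord (n := n)) := by
  unfold ycoord; fun_prop

lemma isOpen_upperHalf (n : ℕ) : IsOpen (upperHalf n) :=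
  isOpen_lt continuous_const (continuous_ycoord n)

lemma line_deriv {n : ℕ} (v : E n → ℝ) (hC2 : ContDiffOn ℝ 2 v (upperHalf n)) (z e : E n)
    (hz : z ∈ upperHalf n) :
    (∀ᶠ t in 𝓝 (0:ℝ), HasDerivAt (fun t : ℝ => v (z + t • e)) (fderiv ℝ v (z + t • e) e) t) ∧
    HasDerivAt (fun t : ℝ => fderiv ℝ v (z + t • e) e)
      (fderiv ℝ (fun w => fderiv ℝ v w e) z e) 0 := by
  have hl : ∀ t : ℝ, HasDerivAt (fun t : ℝ => z + t • e) e t := fun t => by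
    simpa using ((hasDerivAt_id t).smul_const e).const_add z
  constructor
  · have hc : ContinuousAt (fun t : ℝ => z + t • e) 0 := (hl 0).continuousAt
    have : ∀ᶠ t in 𝓝 (0:ℝ), z + t • e ∈ upperHalf n := by
      apply hc.eventually_mem
      simpa using (isOpen_upperHalf n).mem_nhds hz
    filter_upwards [this] with t ht
    have hd : DifferentiableAt ℝ v (z + t • e) :=
      (hC2.differentiableOn (by norm_num)).differentiableAt ((isOpen_upperHalf n).mem_nhds ht)
    exact hd.hasFDerivAt.comp_hasDerivAt t (hl t)
  · have h1 : ContDiffAt ℝ 2 v z := hC2.contDiffAt ((isOpen_upperHalf n).mem_nhds hz)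
    have h2 : ContDiffAt ℝ 1 (fderiv ℝ v) z := h1.fderiv_right (by norm_num)
    have h3 : DifferentiableAt ℝ (fun w => fderiv ℝ v w e) z :=
      (h2.differentiableAt (by norm_num)).clm_apply (differentiableAt_const e)
    have h4 : HasFDerivAt (fun w => fderiv ℝ v w e) (fderiv ℝ (fun w => fderiv ℝ v w e) z)
      (z + (0:ℝ) • e) := by simpa using h3.hasFDerivAt
    exact h4.comp_hasDerivAt 0 (hl 0)

/-- Monotonicity in y. -/
lemma mono_y {n : ℕ} (β : ℝ) (hβ : 0 < β) (v : E n → ℝ) (hpos : ∀ z ∈ upperHalf n, 0 < v z)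
    (hC2 : ContDiffOn ℝ 2 v (upperHalf n))
    (hgrad : ∀ z ∈ upperHalf n,
      ycoord z * ‖gradient (fun z => (v z) ^ (1 / β)) z‖ ≤ (v z) ^ (1 / β))
    (z : E n) (hz : z ∈ upperHalf n) (t : ℝ) (ht : 0 ≤ t) :
    v (z + t • eY n) / (ycoord z + t) ^ β ≤ v z / ycoord z ^ β := by
  have hl : ∀ t : ℝ, HasDerivAt (fun t : ℝ => z + t • eY n) (eY n) t := fun t => by
    simpa using ((hasDerivAt_id t).smul_const (eY n)).const_add z
  have hy : 0 < ycoord z := hz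
  have hmem : ∀ t : ℝ, 0 ≤ t → z + t • eY n ∈ upperHalf n := fun t ht => by
    show 0 < ycoord _
    rw [ycoord_line]; linarith
  set ρ : E n → ℝ := fun z => v z ^ (1/β) with hρ
  have hder : ∀ t : ℝ, 0 ≤ t → HasDerivAt (fun t : ℝ => ρ (z + t • eY n) / (ycoord z + t))
      ((fderiv ℝ ρ (z + t • eY n) (eY n) * (ycoord z + t) - ρ (z + t • eY n) * 1) /
        (ycoord z + t)^2) t := by
    intro t ht
    have hd : DifferentiableAt ℝ v (z + t • eY n) :=
      (hC2.differentiableOn (by norm_num)).differentiableAt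
        ((isOpen_upperHalf n).mem_nhds (hmem t ht))
    have hdρ : DifferentiableAt ℝ ρ (z + t • eY n) :=
      hd.rpow_const (Or.inl (hpos _ (hmem t ht)).ne')
    have h1 := hdρ.hasFDerivAt.comp_hasDerivAt t (hl t)
    exact h1.div ((hasDerivAt_id t).const_add _) (by simp; linarith)
  have hanti : AntitoneOn (fun t : ℝ => ρ (z + t • eY n) / (ycoord z + t)) (Ici 0) := by
    apply antitoneOn_of_deriv_nonpos (convex_Ici 0)
    · exact fun t ht => (hder t ht).continuousAt.continuousWithinAt
    · intro t ht
      rw [interior_Ici] at ht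
      exact (hder t (le_of_lt ht)).differentiableAt.differentiableWithinAt
    · intro t ht
      rw [interior_Ici] at ht
      have ht' : 0 ≤ t := le_of_lt ht
      rw [(hder t ht').deriv]
      apply div_nonpos_of_nonpos_of_nonneg _ (sq_nonneg _)
      have h := hgrad _ (hmem t ht')
      rw [ycoord_line] at h
      have h5 : fderiv ℝ ρ (z + t • eY n) (eY n) ≤ ‖gradient ρ (z + t • eY n)‖ := by
        have : ‖gradient ρ (z + t • eY n)‖ = ‖fderiv ℝ ρ (z + t • eY n)‖ := by
          simp [gradient]
        rw [this]
        refine (le_abs_self _).trans ?_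
        have h6 := (fderiv ℝ ρ (z + t • eY n)).le_opNorm (eY n)
        simpa [eY] using h6
      have h7 : 0 ≤ ycoord z + t := by linarith
      have := mul_le_mul_of_nonneg_left h5 h7
      linarith
  have h := hanti (mem_Ici.2 le_rfl) (mem_Ici.2 ht) ht
  simp only [zero_smul, add_zero] at h
  have key : ∀ q : ℝ, 0 < q → ∀ u : E n, 0 < v u → (ρ u / q) ^ β = v u / q ^ β := by
    intro q hq u hu
    rw [Real.div_rpow (by positivity) hq.le, hρ]
    simp only
    rw [← Real.rpow_mul hu.le, one_div, inv_mul_cancel₀ hβ.ne', Real.rpow_one]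
  rw [← key _ (by linarith) _ (hpos _ (hmem t ht)), ← key _ hy _ (hpos _ hz)]
  apply Real.rpow_le_rpow _ h hβ.le
  have := hpos _ (hmem t ht)
  positivity

/-- The interior contradiction. -/
lemma no_touch {n : ℕ} (γ β s c B k N : ℝ) (hn : 0 < n) (hs : s = β + 2 * γ)
    (hβ : s + β = n) (hc : c * (1 - γ) = n) (hN : 0 < N) (v : E n → ℝ)
    (hC2 : ContDiffOn ℝ 2 v (upperHalf n)) (z : E n) (hz : z ∈ upperHalf n)
    (hpde : (ycoord z) ^ 2 * lap v z - ((n : ℝ) - 1) * ycoord z * partialY v z + s * β * v z = 0)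
    (ψ : E n → ℝ) (hψ : ψ = fun u => ycoord u ^ β *
      (k - N * (‖u‖^2 - (1 + c) * ycoord u ^ 2 + B * ycoord u ^ (2 * γ))))
    (heq : v z = ψ z) (hle : ∀ᶠ u in 𝓝 z, ψ u ≤ v u) : False := by
  have hy : 0 < ycoord z := hz
  have hmin : ∀ e : E n, IsLocalMin (fun t : ℝ => v (z + t • e) - ψ (z + t • e)) 0 := by
    intro e
    have hc : Tendsto (fun t : ℝ => z + t • e) (𝓝 0) (𝓝 z) := by
      have : Continuous (fun t : ℝ => z + t • e) := by fun_prop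
      simpa using this.tendsto 0
    filter_upwards [hc.eventually hle] with t ht
    simp [heq]; exact ht
  set y := ycoord z with hyd
  have hi : ∀ i : Fin (n+1), i ≠ Fin.last n → - (2 * N * y ^ β) ≤
      fderiv ℝ (fun w => fderiv ℝ v w (EuclideanSpace.single i (1 : ℝ))) z
      (EuclideanSpace.single i (1 : ℝ)) := by
    intro i hil
    obtain ⟨h1, h2⟩ := line_deriv v hC2 z (EuclideanSpace.single i (1 : ℝ)) hz
    have hψl : ∀ t : ℝ, ψ (z + t • EuclideanSpace.single i (1 : ℝ)) = y ^ β * (k - N *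
        (‖z‖^2 + 2 * t * z i + t^2 - (1 + c) * y^2 + B * y ^ (2 * γ))) := by
      intro t
      simp only [hψ, ycoord_line' z t i hil, norm_line, hyd]
    have hd : ∀ t : ℝ, HasDerivAt (fun t : ℝ => ψ (z + t • EuclideanSpace.single i (1 : ℝ)))
        (y ^ β * (- (N * (2 * z i + 2 * t)))) t := by
      intro t
      simp only [hψl]
      have e1 : HasDerivAt (fun t : ℝ => 2 * t * z i) (2 * z i) t := by
        simpa using ((hasDerivAt_id t).const_mul 2).mul_const (z i)
      have e2 : HasDerivAt (fun t : ℝ => t^2) (2 * t) t := by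
        simpa using hasDerivAt_pow 2 t
      exact (((((e1.const_add _).add e2).sub_const _).add_const _).const_mul N).const_sub k
        |>.const_mul _
    have hd2 : HasDerivAt (fun t : ℝ => y ^ β * (- (N * (2 * z i + 2 * t))))
        (y ^ β * (- (N * 2))) 0 := by
      have e1 : HasDerivAt (fun t : ℝ => 2 * t) 2 0 := by
        simpa using (hasDerivAt_id (0:ℝ)).const_mul 2
      exact (((e1.const_add _).const_mul N).neg).const_mul _
    have := (second_deriv_test _ _ _ (h1.mono fun t ht => ht.sub (hd t)) (h2.sub hd2) (hmin _)).2
    linarith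
  obtain ⟨h1, h2⟩ := line_deriv v hC2 z (eY n) hz
  have hnl : ∀ t : ℝ, ‖z + t • eY n‖^2 = ‖z‖^2 + 2 * t * y + t^2 := fun t => by
    rw [eY, norm_line]; rfl
  have hpow : ∀ p : ℝ, ∀ t : ℝ, 0 < y + t →
      HasDerivAt (fun t : ℝ => (y + t) ^ p) (p * (y + t) ^ (p - 1)) t := by
    intro p t ht
    have := ((hasDerivAt_id t).const_add y).rpow_const (p := p) (Or.inl (by simpa using ht.ne'))
    simpa using this
  have hev : ∀ᶠ t in 𝓝 (0:ℝ), 0 < y + t := by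
    have : ContinuousAt (fun t : ℝ => y + t) 0 := by fun_prop
    exact this.eventually (lt_mem_nhds (by simpa using hy))
  set K := k - N * (‖z‖^2 - y^2) with hK
  have hψy : ∀ t : ℝ, 0 < y + t → ψ (z + t • eY n) =
      K * (y + t) ^ β + N * c * (y + t) ^ (β + 2) - N * B * (y + t) ^ s := by
    intro t ht
    simp only [hψ, ycoord_line, hnl, ← hyd]
    rw [hs, Real.rpow_add ht, Real.rpow_add ht, Real.rpow_two, hK]
    ring
  have hd : ∀ t : ℝ, 0 < y + t → HasDerivAt (fun t : ℝ => ψ (z + t • eY n))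
      (K * (β * (y + t) ^ (β - 1)) + N * c * ((β + 2) * (y + t) ^ (β + 2 - 1))
        - N * B * (s * (y + t) ^ (s - 1))) t := by
    intro t ht
    have h := (((hpow β t ht).const_mul K).add ((hpow (β + 2) t ht).const_mul (N * c))).sub
      ((hpow s t ht).const_mul (N * B))
    refine h.congr_of_eventuallyEq ?_
    have : ContinuousAt (fun t : ℝ => y + t) t := by fun_prop
    filter_upwards [this.eventually (lt_mem_nhds ht)] with r hr
    exact hψy r hr
  have hd2 := (((hpow (β-1) 0 (by simpa using hy)).const_mul β).const_mul K).add
    (((hpow (β + 2 - 1) 0 (by simpa using hy)).const_mul (β+2)).const_mul (N * c)) |>.sub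
      (((hpow (s-1) 0 (by simpa using hy)).const_mul s).const_mul (N * B))
  obtain ⟨r1, r2⟩ := second_deriv_test _ _ _
    ((h1.and hev).mono fun t ht => ht.1.sub (hd t ht.2)) (h2.sub hd2) (hmin _)
  have hv : v z = K * y ^ β + N * c * y ^ (β + 2) - N * B * y ^ s := by
    rw [heq]; simpa using hψy 0 (by simpa using hy)
  have hsum : lap v z ≥ n * (- (2 * N * y ^ β)) +
      fderiv ℝ (fun w => fderiv ℝ v w (eY n)) z (eY n) := by
    unfold lap
    rw [Fin.sum_univ_castSucc]
    have := Finset.sum_le_sum (s := Finset.univ) (fun (j : Fin n) _ =>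
      hi j.castSucc (Fin.castSucc_lt_last j).ne)
    simp only [Finset.sum_const, Finset.card_univ, Fintype.card_fin, nsmul_eq_mul] at this
    exact add_le_add this le_rfl
  simp only [add_zero, zero_smul] at r1 r2
  change partialY v z - _ = 0 at r1
  have f1 : ∀ p : ℝ, y ^ (p - 1) * y = y ^ p := fun p => by
    rw [← Real.rpow_add_one hy.ne']; ring_nf
  have f2 : ∀ p : ℝ, y ^ (p - 1 - 1) * y ^ 2 = y ^ p := fun p => by
    rw [pow_two, ← mul_assoc, f1, f1]
  have g0 : y ^ (β + 2) = y ^ β * y ^ 2 := by rw [Real.rpow_add hy, Real.rpow_two]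
  have q1 : y * partialY v z = K * β * y ^ β + N * c * (β + 2) * y ^ (β + 2)
      - N * B * s * y ^ s := by
    rw [← f1 β, ← f1 (β+2), ← f1 s, sub_eq_zero.1 r1]; ring
  have q2 : y^2 * lap v z ≥ - (2 * N * n * y ^ (β + 2)) + K * β * (β - 1) * y ^ β +
      N * c * (β + 2) * (β + 1) * y ^ (β + 2) - N * B * s * (s - 1) * y ^ s := by
    have hle := mul_le_mul_of_nonneg_left (hsum.le.trans' (add_le_add_right (sub_nonneg.1 r2) _))
      (sq_nonneg y)
    refine hle.trans' (le_of_eq ?_)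
    rw [g0, ← f2 s]
    have e1 := f2 β
    have e2 := f2 (β + 2)
    rw [g0] at e2
    linear_combination (-K * β * (β - 1)) * e1 - N * c * (β + 2) * (β + 1) * e2
  have hp : 0 < y ^ (β + 2) := by positivity
  have hn' : (0:ℝ) < n := by exact_mod_cast hn
  have : 0 < 2 * N * n * y ^ (β + 2) := by positivity
  have hβ' : (n:ℝ) = 2 * β + 2 * γ := by rw [← hβ, hs]; ring
  have hfin : y^2 * lap v z - ((n : ℝ) - 1) * (y * partialY v z) + s * β * v z ≥
     2 * N * n * y ^ (β + 2) := by
    rw [q1, hv]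
    refine le_trans (le_of_eq ?_) (add_le_add_left (sub_le_sub_right q2 _) _)
    subst hs
    generalize y ^ (β + 2) = Y1
    generalize y ^ (β + 2 * γ) = Y2
    generalize y ^ β = Y0
    clear_value K
    generalize (n : ℝ) = m at hc hβ'
    subst hβ'
    linear_combination (-4 * N * Y1) * hc
  linarith

/-- The extension of `1 - v / y^β` by zero is continuous on the closed half-space. -/
lemma ext_continuous {n : ℕ} (β : ℝ) (v : E n → ℝ)
    (hC2 : ContDiffOn ℝ 2 v (upperHalf n)) (W : E n → ℝ)
    (hW : ∀ z ∈ upperHalf n, W z = 1 - v z / ycoord z ^ β) (hW0 : ∀ z ∉ upperHalf n, W z = 0)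
    (hnn : ∀ z, 0 ≤ W z)
    (hmono : ∀ z ∈ upperHalf n, ∀ t : ℝ, 0 ≤ t → W z ≤ W (z + t • eY n))
    (hl : ∀ z : E n, ycoord z = 0 → Tendsto (fun y : ℝ => W (z + y • eY n)) (𝓝[>] 0) (𝓝 0)) :
    ContinuousOn W {z | 0 ≤ ycoord z} := by
  have hin : ∀ z ∈ upperHalf n, ContinuousAt W z := by
    intro z hz
    have hz' : 0 < ycoord z := hz
    have h1 : ContinuousAt (fun z => 1 - v z / ycoord z ^ β) z := by
      have hv : ContinuousAt v z := hC2.continuousOn.continuousAt ((isOpen_upperHalf n).mem_nhds hz)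
      refine continuousAt_const.sub (hv.div ?_ (by positivity))
      exact (continuous_ycoord n).continuousAt.rpow_const (Or.inl hz'.ne')
    apply h1.congr
    filter_upwards [(isOpen_upperHalf n).mem_nhds hz] with u hu using (hW u hu).symm
  intro z hz
  rcases (show 0 ≤ ycoord z from hz).eq_or_lt with h0 | h0
  swap
  · exact (hin z h0).continuousWithinAt
  have hz0 : W z = 0 := hW0 z (by simp [upperHalf, ← h0])
  apply ContinuousAt.continuousWithinAt
  rw [Metric.continuousAt_iff']
  intro ε hε
  obtain ⟨y0, hy0, hy0'⟩ := (((hl z h0.symm).eventually (gt_mem_nhds hε)).and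
    self_mem_nhdsWithin).exists
  have hy0p : 0 < y0 := hy0'
  have hmap : Continuous (fun u : E n => u + (y0 - ycoord u) • eY n) := by
    have := continuous_ycoord n
    fun_prop
  have hc : ContinuousAt (fun u : E n => W (u + (y0 - ycoord u) • eY n)) z := by
    refine ContinuousAt.comp (f := fun u : E n => u + (y0 - ycoord u) • eY n) (g := W) ?_
      hmap.continuousAt
    apply hin
    show 0 < ycoord _
    rw [ycoord_line]; linarith
  have e1 : ∀ᶠ u in 𝓝 z, W (u + (y0 - ycoord u) • eY n) < ε := by
    apply hc.eventually (gt_mem_nhds _)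
    simpa [← h0] using hy0
  have e2 : ∀ᶠ u in 𝓝 z, ycoord u < y0 :=
    (continuous_ycoord n).continuousAt.eventually (gt_mem_nhds (by rw [← h0]; exact hy0p))
  filter_upwards [e1, e2] with u h1 h2
  rw [hz0, Real.dist_eq, sub_zero, abs_of_nonneg (hnn u)]
  by_cases hu : u ∈ upperHalf n
  · exact (hmono u hu _ (by linarith)).trans_lt h1
  · rw [hW0 u hu]; exact hε

/-- Liouville-type theorem for adapted metrics with `γ ∈ (0,1)`:
if `w = 1 - v/y^{n-s} ∈ H̃^{1,a}`, vanishes on the boundary, and `|∇*_s ρ_s| ≤ 1`,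
then `v = y^{n-s}`. -/
theorem liouville_adapted_metric_gamma_lt_one
    (n : ℕ) (hn : 2 ≤ n) (γ : ℝ) (hγ : γ ∈ Set.Ioo (0 : ℝ) 1)
    (s a : ℝ) (hs : s = (n : ℝ) / 2 + γ) (ha : a = 1 - 2 * γ)
    (v : E n → ℝ) (hpos : ∀ z ∈ upperHalf n, 0 < v z)
    (hC2 : ContDiffOn ℝ 2 v (upperHalf n))
    (hpde : ∀ z ∈ upperHalf n,
      (ycoord z) ^ 2 * lap v z - ((n : ℝ) - 1) * ycoord z * partialY v z +
        s * ((n : ℝ) - s) * v z = 0)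
    (w : E n → ℝ) (hw : ∀ z ∈ upperHalf n, w z = 1 - v z / (ycoord z) ^ ((n : ℝ) - s))
    (hmem : memH1T n a w)
    (hlim : ∀ x : EuclideanSpace ℝ (Fin n),
      Tendsto (fun y => w (pt x y)) (nhdsWithin 0 (Set.Ioi 0)) (nhds 0))
    (hgrad : ∀ z ∈ upperHalf n,
      ycoord z * ‖gradient (fun z => (v z) ^ (1 / ((n : ℝ) - s))) z‖ ≤
        (v z) ^ (1 / ((n : ℝ) - s))) :
    ∀ z ∈ upperHalf n, v z = (ycoord z) ^ ((n : ℝ) - s) := by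

  obtain ⟨hγ0, hγ1⟩ := hγ
  have hn' : (2:ℝ) ≤ n := by exact_mod_cast hn
  obtain ⟨β, hβd⟩ : ∃ β, β = (n:ℝ) - s := ⟨_, rfl⟩
  rw [← hβd]
  simp only [← hβd] at hpde hw hgrad
  have hβ : 0 < β := by rw [hβd, hs]; linarith
  clear hmem
  classical
  have hvert : ∀ z ∈ upperHalf n, ∀ t : ℝ, 0 ≤ t → z + t • eY n ∈ upperHalf n := by
    intro z hz t ht
    have : 0 < ycoord z := hz
    show 0 < ycoord _
    rw [ycoord_line]; linarith
  obtain ⟨W, hWdef⟩ : ∃ W : E n → ℝ, W = fun z => if z ∈ upperHalf n then w z else 0 := ⟨_, rfl⟩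
  have hWw : ∀ z ∈ upperHalf n, W z = w z := fun z hz => by rw [hWdef]; exact if_pos hz
  have hW : ∀ z ∈ upperHalf n, W z = 1 - v z / ycoord z ^ β := fun z hz => by
    rw [hWw z hz, hw z hz]
  have hW0 : ∀ z ∉ upperHalf n, W z = 0 := fun z hz => by rw [hWdef]; exact if_neg hz
  have hmono : ∀ z ∈ upperHalf n, ∀ t : ℝ, 0 ≤ t → W z ≤ W (z + t • eY n) := by
    intro z hz t ht
    rw [hW z hz, hW _ (hvert z hz t ht), ycoord_line]
    have := mono_y β hβ v hpos hC2 hgrad z hz t ht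
    linarith
  have hl : ∀ z : E n, ycoord z = 0 → Tendsto (fun y : ℝ => W (z + y • eY n)) (𝓝[>] 0) (𝓝 0) := by
    intro z hz
    have h := hlim (WithLp.toLp 2 (fun i : Fin n => z i.castSucc))
    refine h.congr' ?_
    filter_upwards [self_mem_nhdsWithin] with y hy
    have hpt : pt (WithLp.toLp 2 (fun i : Fin n => z i.castSucc)) y = z + y • eY n := by
      ext i
      refine Fin.lastCases ?_ (fun j => ?_) i
      · have : z (Fin.last n) = 0 := hz
        simp [pt, eY, this]
      · simp [pt, eY]
    rw [hpt, hWw]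
    show 0 < ycoord _
    rw [ycoord_line, hz, zero_add]; exact hy
  have hnn : ∀ z, 0 ≤ W z := by
    intro z
    by_cases hz : z ∈ upperHalf n
    · have hz' : 0 < ycoord z := hz
      have h0 : ycoord (z + (-ycoord z) • eY n) = 0 := by rw [ycoord_line]; ring
      refine le_of_tendsto (hl _ h0) ?_
      filter_upwards [self_mem_nhdsWithin, nhdsWithin_le_nhds (gt_mem_nhds hz')] with y hy hy2
      have hu : z + (-ycoord z) • eY n + y • eY n ∈ upperHalf n := by
        show 0 < ycoord _
        rw [ycoord_line, h0, zero_add]; exact hy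
      have := hmono _ hu (ycoord z - y) (by linarith)
      have hzz : z + (-ycoord z) • eY n + y • eY n + (ycoord z - y) • eY n = z := by module
      rwa [hzz] at this
    · rw [hW0 z hz]
  have hle1 : ∀ z, W z ≤ 1 := by
    intro z
    by_cases hz : z ∈ upperHalf n
    · rw [hW z hz]
      have : 0 < ycoord z := hz
      have := hpos z hz
      have : 0 < v z / ycoord z ^ β := by positivity
      linarith
    · rw [hW0 z hz]; norm_num
  have hcont := ext_continuous β v hC2 W hW hW0 hnn hmono hl
  obtain ⟨c, hcd⟩ : ∃ c : ℝ, c = n / (1 - γ) := ⟨_, rfl⟩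
  have h1γ : 0 < 1 - γ := by linarith
  have hc : c * (1 - γ) = n := by rw [hcd]; field_simp
  have hc0 : 0 < c := by rw [hcd]; positivity
  have key : ∀ R : ℝ, 0 < R → ∀ z ∈ upperHalf n, ‖z‖ ≤ R →
      W z ≤ (R^2)⁻¹ * (‖z‖^2 - (1 + c) * ycoord z ^ 2 +
        ((1 + c) * R ^ (2 - 2 * γ)) * ycoord z ^ (2 * γ)) := by
    intro R hR
    set B := (1 + c) * R ^ (2 - 2 * γ) with hB
    set h : E n → ℝ := fun z => (R^2)⁻¹ * (‖z‖^2 - (1 + c) * ycoord z ^ 2 +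
      B * ycoord z ^ (2 * γ)) with hh
    have hK : IsCompact (Metric.closedBall (0 : E n) R ∩ {z | 0 ≤ ycoord z}) :=
      (isCompact_closedBall _ _).inter_right (isClosed_le continuous_const (continuous_ycoord n))
    have hhc : Continuous h := by
      have h1 := continuous_ycoord n
      have h2 : Continuous fun z : E n => ycoord z ^ (2 * γ) :=
        h1.rpow_const fun _ => Or.inr (by linarith)
      fun_prop
    obtain ⟨z0, ⟨hz0R, hz0y⟩, hmax⟩ := hK.exists_isMaxOn
      ⟨0, by simp [hR.le, ycoord]⟩ ((hcont.mono inter_subset_right).sub hhc.continuousOn)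
    have hR0 : ‖z0‖ ≤ R := by simpa using hz0R
    have hy0 : 0 ≤ ycoord z0 := hz0y
    have main : W z0 - h z0 ≤ 0 := by
      by_contra hpos0
      push Not at hpos0
      rcases hy0.eq_or_lt with h0 | h0
      · have : W z0 = 0 := hW0 z0 (by simp [upperHalf, ← h0])
        have h2 : h z0 = (R^2)⁻¹ * ‖z0‖^2 := by
          simp only [hh, ← h0]
          rw [Real.zero_rpow (by linarith)]; ring
        have : 0 ≤ h z0 := by rw [h2]; positivity
        linarith
      rcases hR0.eq_or_lt with hRe | hRl
      · have hyR : ycoord z0 ≤ R := by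
          rw [← hRe]
          exact (le_abs_self _).trans (by simpa [ycoord] using PiLp.norm_apply_le z0 (Fin.last n))
        have h3 : ycoord z0 ^ 2 ≤ R ^ (2 - 2 * γ) * ycoord z0 ^ (2 * γ) := by
          have : ycoord z0 ^ 2 = ycoord z0 ^ (2 - 2 * γ) * ycoord z0 ^ (2 * γ) := by
            rw [← Real.rpow_add h0, ← Real.rpow_two]; ring_nf
          rw [this]
          gcongr
          linarith
        have h4 : 1 ≤ h z0 := by
          simp only [hh, hRe, hB]
          rw [inv_mul_eq_div, le_div_iff₀ (by positivity)]
          have := mul_le_mul_of_nonneg_left h3 (show 0 ≤ 1 + c by linarith)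
          linarith
        linarith [hle1 z0]
      · have hz0 : z0 ∈ upperHalf n := h0
        set M := W z0 - h z0 with hM
        refine no_touch γ β s c B (1 - M) ((R^2)⁻¹) (by omega) ?_ ?_ hc (by positivity) v hC2 z0 hz0
          (hpde z0 hz0) (fun u => ycoord u ^ β * (1 - M - h u)) ?_ ?_ ?_
        · rw [hβd, hs]; ring
        · rw [hβd]; ring
        · rfl
        · simp only [hM, hW z0 hz0]
          have : 0 < ycoord z0 ^ β := by positivity
          field_simp
          ring
        · have e1 : ∀ᶠ u in 𝓝 z0, ‖u‖ < R := continuous_norm.continuousAt.eventually (gt_mem_nhds hRl)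
          filter_upwards [e1, (isOpen_upperHalf n).mem_nhds hz0] with u hu1 hu2
          have hu3 : 0 < ycoord u := hu2
          have h5 : W u - h u ≤ M := hmax ⟨by simpa using hu1.le, hu3.le⟩
          rw [hW u hu2] at h5
          have h6 : 0 < ycoord u ^ β := by positivity
          have h7 : 1 - M - h u ≤ v u / ycoord u ^ β := by linarith
          rw [le_div_iff₀ h6] at h7
          linarith
    intro z hz hzR
    have h8 : W z - h z ≤ W z0 - h z0 := hmax ⟨by simpa using hzR, (show 0 < ycoord z from hz).le⟩
    linarith
  intro z hz
  have hy : 0 < ycoord z := hz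
  have hlimR : Tendsto (fun R : ℝ => (R^2)⁻¹ * (‖z‖^2 - (1 + c) * ycoord z ^ 2) +
        ((1 + c) * R ^ (- (2 * γ))) * ycoord z ^ (2 * γ)) atTop (𝓝 0) := by
    have t1 : Tendsto (fun R : ℝ => (R^2)⁻¹) atTop (𝓝 0) :=
      (tendsto_pow_atTop (by norm_num)).inv_tendsto_atTop
    have t2 : Tendsto (fun R : ℝ => R ^ (-(2 * γ))) atTop (𝓝 0) :=
      tendsto_rpow_neg_atTop (by linarith)
    simpa using (t1.mul_const (‖z‖^2 - (1 + c) * ycoord z ^ 2)).add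
      ((t2.const_mul (1 + c)).mul_const (ycoord z ^ (2 * γ)))
  have hWz : W z ≤ 0 := by
    refine ge_of_tendsto hlimR ?_
    filter_upwards [eventually_gt_atTop 0, eventually_ge_atTop ‖z‖] with R hR hzR
    refine (key R hR z hz hzR).trans (le_of_eq ?_)
    have : R ^ (-(2 * γ)) = (R^2)⁻¹ * R ^ (2 - 2 * γ) := by
      rw [sub_eq_add_neg, Real.rpow_add hR, Real.rpow_two]
      field_simp
    rw [this]; ring
  have h9 : W z = 0 := le_antisymm hWz (hnn z)
  rw [hW z hz] at h9
  have h6 : 0 < ycoord z ^ β := by positivity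
  have : v z / ycoord z ^ β = 1 := by linarith
  rwa [div_eq_one_iff_eq h6.ne'] at this

end
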